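/- Let S be a (2,ω)-divisible Cu-semigroup satisfying (O5), let u ∈ S be strongly soft, and let u',x ∈ S be such that u' ≪ u ≪ x. Then there exists a strongly soft element c ∈ S satisfying u'+2c ≤ x ≤ ∞c. -/

import Mathlib

open Set

/-- The way-below relation: `x ≪ y` if for every increasing sequence with a
supremum dominating `y`, some term of the sequence dominates `x`. -/
def WayBelow {S : Type*} [Preorder S] (x y : S) : Prop :=
  ∀ z : ℕ → S, Monotone z → ∀ s : S, IsLUB (Set.range z) s → y ≤ s → ∃ m : ℕ, x ≤ z m

/-- A Cu-semigroup: a positively ordered commutative monoid satisfying (O1)-(O4). -/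
class CuSemigroup (S : Type*) extends AddCommMonoid S, PartialOrder S where
  zero_le : ∀ x : S, 0 ≤ x
  add_mono : ∀ {a b c d : S}, a ≤ b → c ≤ d → a + c ≤ b + d
  O1 : ∀ z : ℕ → S, Monotone z → ∃ s : S, IsLUB (Set.range z) s
  O2 : ∀ x : S, ∃ z : ℕ → S, (∀ n, WayBelow (z n) (z (n + 1))) ∧ IsLUB (Set.range z) x
  O3 : ∀ {x' x y' y : S}, WayBelow x' x → WayBelow y' y → WayBelow (x' + y') (x + y)
  O4 : ∀ (x y : ℕ → S), Monotone x → Monotone y → ∀ sx sy : S,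
      IsLUB (Set.range x) sx → IsLUB (Set.range y) sy →
      IsLUB (Set.range fun n => x n + y n) (sx + sy)

variable {S : Type*}

lemma CuSemigroup.nsmul_mono [CuSemigroup S] (x : S) : Monotone fun n : ℕ => n • x := by
  intro n m h
  obtain ⟨k, rfl⟩ := Nat.exists_eq_add_of_le h
  show n • x ≤ (n + k) • x
  rw [add_nsmul]
  calc n • x = n • x + 0 := by rw [add_zero]
    _ ≤ n • x + k • x := CuSemigroup.add_mono le_rfl (CuSemigroup.zero_le _)

/-- `infty x` is the supremum of the increasing sequence `n • x`, i.e. `∞x`. -/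
noncomputable def infty [CuSemigroup S] (x : S) : S :=
  (CuSemigroup.O1 (fun n : ℕ => n • x) (CuSemigroup.nsmul_mono x)).choose

lemma infty_isLUB [CuSemigroup S] (x : S) :
    IsLUB (Set.range fun n : ℕ => n • x) (infty x) :=
  (CuSemigroup.O1 (fun n : ℕ => n • x) (CuSemigroup.nsmul_mono x)).choose_spec

/-- An element is strongly soft if every `x' ≪ x` admits `t` with `x' + t ≪ x`
and `x' ≪ ∞t`. -/
def StronglySoft [CuSemigroup S] (x : S) : Prop :=
  ∀ x' : S, WayBelow x' x → ∃ t : S, WayBelow (x' + t) x ∧ WayBelow x' (infty t)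

def SatisfiesO5 (S : Type*) [CuSemigroup S] : Prop :=
  ∀ x' x y' y z : S, WayBelow x' x → WayBelow y' y → x + y ≤ z →
    ∃ c : S, WayBelow y' c ∧ x' + c ≤ z ∧ z ≤ x + c

def SatisfiesO6 (S : Type*) [CuSemigroup S] : Prop :=
  ∀ x' x y z : S, WayBelow x' x → WayBelow x (y + z) →
    ∃ v w : S, v ≤ x ∧ v ≤ y ∧ w ≤ x ∧ w ≤ z ∧ x' ≤ v + w

def SatisfiesO7 (S : Type*) [CuSemigroup S] : Prop :=
  ∀ x' x y' y w : S, WayBelow x' x → x ≤ w → WayBelow y' y → y ≤ w →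
    ∃ z : S, WayBelow x' z ∧ WayBelow y' z ∧ z ≤ w ∧ z ≤ x + y

def TwoOmegaDivisible (S : Type*) [CuSemigroup S] : Prop :=
  ∀ x' x : S, WayBelow x' x → ∃ y : S, 2 • y ≤ x ∧ x' ≤ infty y

def WeaklyCancellative (S : Type*) [CuSemigroup S] : Prop :=
  ∀ x y z : S, WayBelow (x + z) (y + z) → WayBelow x y

def Separative (S : Type*) [CuSemigroup S] : Prop :=
  ∀ x y t : S, WayBelow (x + t) (y + t) → WayBelow t (infty x) → WayBelow t (infty y) →
    WayBelow x y

def LeftSoftSeparative (S : Type*) [CuSemigroup S] : Prop :=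
  ∀ x y t : S, StronglySoft x → WayBelow (x + t) (y + t) → WayBelow t (infty x) →
    WayBelow t (infty y) → WayBelow x y

def AlmostUnperforated (S : Type*) [CuSemigroup S] : Prop :=
  ∀ x y : S, (∃ n : ℕ, 1 ≤ n ∧ (n + 1) • x ≤ n • y) → x ≤ y

def CountablyBased (S : Type*) [CuSemigroup S] : Prop :=
  ∃ D : Set S, D.Countable ∧
    ∀ x : S, ∃ z : ℕ → S, Monotone z ∧ (∀ n, z n ∈ D) ∧ IsLUB (Set.range z) x

/-- `Lset x` is the set `L_x = { u' : u' ≪ u ≪ x for some strongly soft u }`. -/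
def Lset [CuSemigroup S] (x : S) : Set S :=
  { u' | ∃ u : S, StronglySoft u ∧ WayBelow u' u ∧ WayBelow u x }

/-- A functional on a Cu-semigroup: a monoid morphism to `[0,∞]` preserving order
and suprema of increasing sequences. -/
structure CuFunctional (S : Type*) [CuSemigroup S] where
  toFun : S → ENNReal
  map_zero : toFun 0 = 0
  map_add : ∀ x y : S, toFun (x + y) = toFun x + toFun y
  mono : ∀ x y : S, x ≤ y → toFun x ≤ toFun y
  map_sup : ∀ z : ℕ → S, Monotone z → ∀ s : S, IsLUB (Set.range z) s →
    toFun s = ⨆ n, toFun (z n)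

/-- Predicate version: `f : S → [0,∞]` is a functional on `S`. -/
def IsCuFunctional [CuSemigroup S] (f : S → ENNReal) : Prop :=
  f 0 = 0 ∧ (∀ x y : S, f (x + y) = f x + f y) ∧ (∀ x y : S, x ≤ y → f x ≤ f y) ∧
  (∀ z : ℕ → S, Monotone z → ∀ s : S, IsLUB (Set.range z) s → f s = ⨆ n, f (z n))

/-- Least upper bound of `A` computed within the subset `T`. -/
def IsLUBIn [CuSemigroup S] (T : Set S) (A : Set S) (s : S) : Prop :=
  s ∈ T ∧ s ∈ upperBounds A ∧ ∀ b ∈ T, b ∈ upperBounds A → s ≤ b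

/-- The way-below relation computed within the subset `T`. -/
def WayBelowIn [CuSemigroup S] (T : Set S) (x y : S) : Prop :=
  ∀ z : ℕ → S, Monotone z → (∀ n, z n ∈ T) → ∀ s : S, IsLUBIn T (Set.range z) s → y ≤ s →
    ∃ m : ℕ, x ≤ z m

/-- `T` is a sub-Cu-semigroup of `S`: a submonoid which is itself a Cu-semigroup
for the inherited order, such that the inclusion preserves suprema of increasing
sequences and the way-below relation. -/
structure IsSubCuSemigroup [CuSemigroup S] (T : Set S) : Prop where
  zero_mem : (0 : S) ∈ T
  add_mem : ∀ {x y : S}, x ∈ T → y ∈ T → x + y ∈ T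
  o1 : ∀ z : ℕ → S, Monotone z → (∀ n, z n ∈ T) → ∃ s : S, IsLUBIn T (Set.range z) s
  o2 : ∀ x ∈ T, ∃ z : ℕ → S, (∀ n, z n ∈ T) ∧ (∀ n, WayBelowIn T (z n) (z (n + 1))) ∧
        IsLUBIn T (Set.range z) x
  o3 : ∀ {x' x y' y : S}, x' ∈ T → x ∈ T → y' ∈ T → y ∈ T →
        WayBelowIn T x' x → WayBelowIn T y' y → WayBelowIn T (x' + y') (x + y)
  o4 : ∀ (x y : ℕ → S), Monotone x → Monotone y → (∀ n, x n ∈ T) → (∀ n, y n ∈ T) →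
        ∀ sx sy : S, IsLUBIn T (Set.range x) sx → IsLUBIn T (Set.range y) sy →
        IsLUBIn T (Set.range fun n => x n + y n) (sx + sy)
  incl_sup : ∀ z : ℕ → S, Monotone z → (∀ n, z n ∈ T) → ∀ s : S,
        IsLUBIn T (Set.range z) s → IsLUB (Set.range z) s
  incl_wayBelow : ∀ {x y : S}, x ∈ T → y ∈ T → WayBelowIn T x y → WayBelow x y

def SatisfiesO5In [CuSemigroup S] (T : Set S) : Prop :=
  ∀ x' x y' y z : S, x' ∈ T → x ∈ T → y' ∈ T → y ∈ T → z ∈ T →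
    WayBelowIn T x' x → WayBelowIn T y' y → x + y ≤ z →
    ∃ c ∈ T, WayBelowIn T y' c ∧ x' + c ≤ z ∧ z ≤ x + c

def SatisfiesO6In [CuSemigroup S] (T : Set S) : Prop :=
  ∀ x' x y z : S, x' ∈ T → x ∈ T → y ∈ T → z ∈ T →
    WayBelowIn T x' x → WayBelowIn T x (y + z) →
    ∃ v ∈ T, ∃ w ∈ T, v ≤ x ∧ v ≤ y ∧ w ≤ x ∧ w ≤ z ∧ x' ≤ v + w

def SatisfiesO7In [CuSemigroup S] (T : Set S) : Prop :=
  ∀ x' x y' y w : S, x' ∈ T → x ∈ T → y' ∈ T → y ∈ T → w ∈ T →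
    WayBelowIn T x' x → x ≤ w → WayBelowIn T y' y → y ≤ w →
    ∃ z ∈ T, WayBelowIn T x' z ∧ WayBelowIn T y' z ∧ z ≤ w ∧ z ≤ x + y

/-- `f` is a functional on the sub-Cu-semigroup `T` (values off `T` are irrelevant). -/
def IsFunctionalOn [CuSemigroup S] (T : Set S) (f : S → ENNReal) : Prop :=
  f 0 = 0 ∧
  (∀ x ∈ T, ∀ y ∈ T, f (x + y) = f x + f y) ∧
  (∀ x ∈ T, ∀ y ∈ T, x ≤ y → f x ≤ f y) ∧
  (∀ z : ℕ → S, Monotone z → (∀ n, z n ∈ T) → ∀ s : S, IsLUBIn T (Set.range z) s →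
    f s = ⨆ n, f (z n))

/-- An element is full if `x ≤ ∞e` for every `x`. -/
def IsFull [CuSemigroup S] (e : S) : Prop := ∀ x : S, x ≤ infty e

/-- Condition (R1) for `r`: comparison of `x` with `y` whenever
`λ(x) + r·λ(e) ≤ λ(y)` for all functionals. -/
def SatisfiesR1 (S : Type*) [CuSemigroup S] (e : S) (r : NNReal) : Prop :=
  ∀ x y : S,
    (∀ lam : CuFunctional S, lam.toFun x + (r : ENNReal) * lam.toFun e ≤ lam.toFun y) → x ≤ y

/-- The radius of comparison of `(S, e)`. -/
noncomputable def rc (S : Type*) [CuSemigroup S] (e : S) : ENNReal :=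
  ⨅ r ∈ {r : NNReal | 0 < r ∧ SatisfiesR1 S e r}, (r : ENNReal)

/-- Condition (R1) for the sub-Cu-semigroup `T`. -/
def SatisfiesR1On [CuSemigroup S] (T : Set S) (e : S) (r : NNReal) : Prop :=
  ∀ x ∈ T, ∀ y ∈ T,
    (∀ f : S → ENNReal, IsFunctionalOn T f → f x + (r : ENNReal) * f e ≤ f y) → x ≤ y

/-- The radius of comparison of `(T, e)` for a sub-Cu-semigroup `T ⊆ S`. -/
noncomputable def rcOn [CuSemigroup S] (T : Set S) (e : S) : ENNReal :=
  ⨅ r ∈ {r : NNReal | 0 < r ∧ SatisfiesR1On T e r}, (r : ENNReal)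

/-- `dim S ≤ n` in the sense of covering dimension of Cu-semigroups. -/
def DimLe (S : Type*) [CuSemigroup S] (n : ℕ) : Prop :=
  ∀ (x' x : S) (r : ℕ) (y : Fin r → S), WayBelow x' x → WayBelow x (∑ j, y j) →
    ∃ z : Fin r → Fin (n + 1) → S,
      (∀ j k, WayBelow (z j k) (y j)) ∧
      WayBelow x' (∑ j, ∑ k, z j k) ∧
      (∀ k, WayBelow (∑ j, z j k) x)

/-- The covering dimension of a Cu-semigroup, in `ℕ ∪ {∞}`. -/
noncomputable def cuDim (S : Type*) [CuSemigroup S] : ℕ∞ :=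
  ⨅ n ∈ {n : ℕ | DimLe S n}, (n : ℕ∞)

/-- `dim T ≤ n` for a sub-Cu-semigroup `T ⊆ S`. -/
def DimLeOn [CuSemigroup S] (T : Set S) (n : ℕ) : Prop :=
  ∀ (x' x : S), x' ∈ T → x ∈ T → ∀ (r : ℕ) (y : Fin r → S), (∀ j, y j ∈ T) →
    WayBelowIn T x' x → WayBelowIn T x (∑ j, y j) →
    ∃ z : Fin r → Fin (n + 1) → S,
      (∀ j k, z j k ∈ T) ∧
      (∀ j k, WayBelowIn T (z j k) (y j)) ∧
      WayBelowIn T x' (∑ j, ∑ k, z j k) ∧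
      (∀ k, WayBelowIn T (∑ j, z j k) x)

/-- The covering dimension of a sub-Cu-semigroup `T ⊆ S`. -/
noncomputable def cuDimOn [CuSemigroup S] (T : Set S) : ℕ∞ :=
  ⨅ n ∈ {n : ℕ | DimLeOn T n}, (n : ℕ∞)

instance CuSemigroup.isOrderedAddMonoid [CuSemigroup S] : IsOrderedAddMonoid S where
  add_le_add_left _ _ h _ := CuSemigroup.add_mono h le_rfl

section WayBelow

lemma WayBelow.le [Preorder S] {x y : S} (h : WayBelow x y) : x ≤ y :=
  (h (fun _ => y) monotone_const y (by simp) le_rfl).elim fun _ h => h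

lemma WayBelow.trans_le [Preorder S] {x y z : S} (h : WayBelow x y) (h' : y ≤ z) :
    WayBelow x z :=
  fun w hw s hs hz => h w hw s hs (h'.trans hz)

lemma LE.le.trans_wayBelow [Preorder S] {x y z : S} (h : x ≤ y) (h' : WayBelow y z) :
    WayBelow x z := fun w hw s hs hz =>
  (h' w hw s hs hz).imp fun _ hm => h.trans hm

end WayBelow

namespace CuSemigroup

variable [CuSemigroup S]

lemma exists_wayBelow_between {x y : S} (h : WayBelow x y) :
    ∃ z, WayBelow x z ∧ WayBelow z y := by
  obtain ⟨e, he, hs⟩ := O2 y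
  have hm : Monotone e := monotone_nat_of_le_succ fun n => (he n).le
  obtain ⟨n, hn⟩ := h e hm y hs le_rfl
  exact ⟨e (n + 1), hn.trans_wayBelow (he n), (he (n + 1)).trans_le (hs.1 ⟨_, rfl⟩)⟩

lemma isLUB_nsmul {e : ℕ → S} (he : Monotone e) {x : S} (hx : IsLUB (Set.range e) x) (n : ℕ) :
    IsLUB (Set.range fun k => n • e k) (n • x) := by
  induction n with
  | zero => simp
  | succ n ih =>
    simp only [succ_nsmul]
    exact O4 _ _ (fun _ _ h => nsmul_le_nsmul_right (he h) n) he _ _ ih hx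

lemma nsmul_le_infty (n : ℕ) (x : S) : n • x ≤ infty x :=
  (infty_isLUB x).1 ⟨n, rfl⟩

lemma le_infty (x : S) : x ≤ infty x := by
  simpa using nsmul_le_infty 1 x

lemma infty_mono {x y : S} (h : x ≤ y) : infty x ≤ infty y := by
  refine (infty_isLUB x).2 ?_
  rintro _ ⟨n, rfl⟩
  exact (nsmul_le_nsmul_right h n).trans (nsmul_le_infty n y)

lemma infty_add_infty_le (x : S) : infty x + infty x ≤ infty x := by
  refine (O4 _ _ (nsmul_mono x) (nsmul_mono x) _ _ (infty_isLUB x) (infty_isLUB x)).2 ?_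
  rintro _ ⟨n, rfl⟩
  simpa only [← add_nsmul] using nsmul_le_infty (n + n) x

lemma add_le_infty {x y z : S} (hx : x ≤ infty z) (hy : y ≤ infty z) : x + y ≤ infty z :=
  (add_le_add hx hy).trans (infty_add_infty_le z)

lemma nsmul_le_infty_of_le {x y : S} (h : x ≤ infty y) (n : ℕ) : n • x ≤ infty y := by
  induction n with
  | zero => simpa using zero_le (infty y)
  | succ n ih => rw [succ_nsmul]; exact add_le_infty ih h

lemma infty_le_infty {x y : S} (h : x ≤ infty y) : infty x ≤ infty y := by
  refine (infty_isLUB x).2 ?_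
  rintro _ ⟨n, rfl⟩
  exact nsmul_le_infty_of_le h n

lemma exists_wayBelow_infty {a b : S} (h : WayBelow a (infty b)) :
    ∃ b', WayBelow b' b ∧ WayBelow a (infty b') := by
  obtain ⟨a₁, h₁, h'⟩ := exists_wayBelow_between h
  obtain ⟨a₂, h₂, h₃⟩ := exists_wayBelow_between h'
  obtain ⟨n, hn⟩ := h₃ _ (nsmul_mono b) _ (infty_isLUB b) le_rfl
  obtain ⟨e, he, hs⟩ := O2 b
  have hm : Monotone e := monotone_nat_of_le_succ fun n => (he n).le
  obtain ⟨k, hk⟩ := (h₂.trans_le hn) (fun k => n • e k)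
    (fun _ _ h => nsmul_le_nsmul_right (hm h) n) _ (isLUB_nsmul hm hs n) le_rfl
  exact ⟨e k, (he k).trans_le (hs.1 ⟨_, rfl⟩), h₁.trans_le (hk.trans (nsmul_le_infty n _))⟩

end CuSemigroup

open CuSemigroup

lemma TwoOmegaDivisible.exists_two_nsmul_le [CuSemigroup S] (hdiv : TwoOmegaDivisible S)
    {a r : S} (h : WayBelow a (infty r)) : ∃ y : S, 2 • y ≤ r ∧ WayBelow a (infty y) := by
  obtain ⟨r', hr', ha⟩ := exists_wayBelow_infty h
  obtain ⟨y, hy, hr⟩ := hdiv r' r hr'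
  exact ⟨y, hy, ha.trans_le (infty_le_infty hr)⟩

lemma exists_two_nsmul_add_le [CuSemigroup S] (hdiv : TwoOmegaDivisible S)
    (hO5 : SatisfiesO5 S) {a r : S} (h : WayBelow a (infty r)) :
    ∃ d s : S, 2 • d + s ≤ r ∧ a ≤ infty d ∧ r ≤ infty s ∧ WayBelow d r := by
  obtain ⟨y, hy, hay⟩ := hdiv.exists_two_nsmul_le h
  obtain ⟨z, hz, haz⟩ := hdiv.exists_two_nsmul_le hay
  obtain ⟨z₁, hz₁, ha⟩ := exists_wayBelow_infty haz
  obtain ⟨z₂, h₁₂, hz₂⟩ := exists_wayBelow_between hz₁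
  obtain ⟨z₃, h₂₃, hz₃⟩ := exists_wayBelow_between hz₂
  have hzy : z + z ≤ y := by rwa [← two_nsmul]
  have hyr : y + y ≤ r := by rwa [← two_nsmul]
  obtain ⟨s, hs, hle, hge⟩ := hO5 (z₁ + z₁) (z₂ + z₂) (z₃ + z₃) (z + z) r
    (O3 h₁₂ h₁₂) (O3 hz₃ hz₃)
    ((add_le_add ((add_le_add hz₂.le hz₂.le).trans hzy) hzy).trans hyr)
  refine ⟨z₁, s, by rwa [two_nsmul], ha.le, ?_, ?_⟩
  · have : z₂ + z₂ ≤ s := (add_le_add h₂₃.le h₂₃.le).trans hs.le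
    exact hge.trans (add_le_infty (this.trans (le_infty s)) (le_infty s))
  · refine hz₁.trans_le ?_
    calc z ≤ z + z := le_add_of_nonneg_right (zero_le z)
      _ ≤ y := hzy
      _ ≤ y + y := le_add_of_nonneg_right (zero_le y)
      _ ≤ r := hyr

lemma stronglySoft_of_isLUB [CuSemigroup S] {D d : ℕ → S} {c : S}
    (hD : ∀ n, D (n + 1) = D n + d n) (hd : ∀ n, D n ≤ infty (d n))
    (hc : IsLUB (Set.range D) c) : StronglySoft c := by
  intro x' hx'
  have hm : Monotone D := monotone_nat_of_le_succ fun n => by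
    rw [hD]; exact le_add_of_nonneg_right (zero_le _)
  obtain ⟨x₁, h₁, h₂⟩ := exists_wayBelow_between hx'
  obtain ⟨n, hn⟩ := h₂ D hm c hc le_rfl
  obtain ⟨t, ht, hxt⟩ := exists_wayBelow_infty (h₁.trans_le (hn.trans (hd n)))
  refine ⟨t, (O3 h₁ ht).trans_le ?_, hxt⟩
  calc x₁ + d n ≤ D n + d n := by gcongr
    _ = D (n + 1) := (hD n).symm
    _ ≤ c := hc.1 ⟨_, rfl⟩

lemma exists_stronglySoft_two_nsmul_le [CuSemigroup S] (hdiv : TwoOmegaDivisible S)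
    (hO5 : SatisfiesO5 S) (w : S) :
    ∃ c : S, StronglySoft c ∧ 2 • c ≤ w ∧ w ≤ infty c := by
  obtain ⟨e, he, hw⟩ := O2 w
  let I : S × S → Prop := fun p =>
    2 • p.1 + p.2 ≤ w ∧ w ≤ infty p.2 ∧ WayBelow p.1 (infty w)
  have step : ∀ (n : ℕ) (p : {p // I p}), ∃ (q : {q // I q}) (d : S),
      q.1.1 = p.1.1 + d ∧ p.1.1 ≤ infty d ∧ e n ≤ infty d := by
    rintro n ⟨⟨D, r⟩, hle, hr, hD⟩
    have hen : WayBelow (e n) (infty w) :=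
      (he n).trans_le ((hw.1 ⟨_, rfl⟩).trans (le_infty w))
    have ha : WayBelow (D + e n) (infty r) :=
      (O3 hD hen).trans_le ((infty_add_infty_le w).trans (infty_le_infty hr))
    obtain ⟨d, s, hds, had, hrs, hdr⟩ := exists_two_nsmul_add_le hdiv hO5 ha
    have hrw : r ≤ w := (le_add_of_nonneg_left (zero_le _)).trans hle
    refine ⟨⟨(D + d, s), ?_, hr.trans (infty_le_infty hrs), ?_⟩, d, rfl,
      (le_add_of_nonneg_right (zero_le _)).trans had,
      (le_add_of_nonneg_left (zero_le _)).trans had⟩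
    · calc 2 • (D + d) + s = 2 • D + (2 • d + s) := by rw [nsmul_add, add_assoc]
        _ ≤ 2 • D + r := by gcongr
        _ ≤ w := hle
    · exact (O3 hD (hdr.trans_le (hrw.trans (le_infty w)))).trans_le (infty_add_infty_le w)
  choose next d hnext hsoft hfull using step
  have h0 : I (0, w) := by
    refine ⟨by simp, le_infty w, fun z _ _ _ _ => ⟨0, zero_le _⟩⟩
  let p : ℕ → {p // I p} := fun n => Nat.rec ⟨(0, w), h0⟩ next n
  have hp : ∀ n, (p (n + 1)).1.1 = (p n).1.1 + d n (p n) := fun n => hnext n (p n)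
  have hm : Monotone fun n => (p n).1.1 := monotone_nat_of_le_succ fun n => by
    rw [hp]; exact le_add_of_nonneg_right (zero_le _)
  obtain ⟨c, hc⟩ := O1 _ hm
  refine ⟨c, stronglySoft_of_isLUB hp (fun n => hsoft n (p n)) hc, ?_, ?_⟩
  · refine (isLUB_nsmul hm hc 2).2 ?_
    rintro _ ⟨n, rfl⟩
    exact (le_add_of_nonneg_right (zero_le _)).trans (p n).2.1
  · refine hw.2 ?_
    rintro _ ⟨n, rfl⟩
    refine (hfull n (p n)).trans (infty_mono ?_)
    calc d n (p n) ≤ (p n).1.1 + d n (p n) := le_add_of_nonneg_left (zero_le _)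
      _ = (p (n + 1)).1.1 := (hp n).symm
      _ ≤ c := hc.1 ⟨n + 1, rfl⟩

lemma StronglySoft.exists_add_le [CuSemigroup S] (hO5 : SatisfiesO5 S)
    {u u' x : S} (hu : StronglySoft u) (h1 : WayBelow u' u) (h2 : u ≤ x) :
    ∃ w : S, u' + w ≤ x ∧ x ≤ infty w := by
  obtain ⟨v, huv, hvu⟩ := exists_wayBelow_between h1
  obtain ⟨t, hvt, hv⟩ := hu v hvu
  obtain ⟨t', ht', hv'⟩ := exists_wayBelow_infty hv
  obtain ⟨w, hw, hle, hge⟩ := hO5 u' v t' t x huv ht' (hvt.le.trans h2)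
  exact ⟨w, hle, hge.trans (add_le_infty (hv'.le.trans (infty_mono hw.le)) (le_infty w))⟩

/-- In a (2,ω)-divisible Cu-semigroup satisfying (O5), given a
strongly soft `u` with `u' ≪ u ≪ x`, there is a strongly soft `c` with
`u' + 2c ≤ x ≤ ∞c`. -/
theorem exists_soft_interpolant {S : Type*} [CuSemigroup S]
    (hdiv : TwoOmegaDivisible S) (hO5 : SatisfiesO5 S)
    {u u' x : S} (hu : StronglySoft u) (h1 : WayBelow u' u) (h2 : WayBelow u x) :
    ∃ c : S, StronglySoft c ∧ u' + 2 • c ≤ x ∧ x ≤ infty c := by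
  obtain ⟨w, hle, hxw⟩ := hu.exists_add_le hO5 h1 h2.le
  obtain ⟨c, hc, hcw, hwc⟩ := exists_stronglySoft_two_nsmul_le hdiv hO5 w
  exact ⟨c, hc, (add_le_add le_rfl hcw).trans hle, hxw.trans (infty_le_infty hwc)⟩
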